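/- arXiv:2010.08581 — 3 statements merged into one kernel-verified Lean document; each statement's English description precedes it below -/
import Mathlib

section
/- Let G^{(1)}, …, G^{(N)} be TR cores with G^{(j)} ∈ ℝ^{R_{j-1} × I_j × R_j} and R_0 = R_N, and fix n ∈ [N]. Then the column space of the mode-2 unfolding G_{[2]}^{≠n} of the subchain tensor G^{≠n} is contained in the column space of the Kronecker product G_{(2)}^{(n-1)} ⊗ ⋯ ⊗ G_{(2)}^{(1)} ⊗ G_{(2)}^{(N)} ⊗ ⋯ ⊗ G_{(2)}^{(n+1)} of the classical mode-2 unfoldings of the remaining cores. -/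
noncomputable section

/-- Column space of a real matrix, as a submodule of Euclidean space. -/
def colSpace {m n : Type*} [Fintype m] [Fintype n] [DecidableEq n]
    (A : Matrix m n ℝ) : Submodule ℝ (EuclideanSpace ℝ m) :=
  LinearMap.range (Matrix.toEuclideanLin A)

/-- The classical mode-2 unfolding `G_(2)^(j)` of the `j`-th TR core: the matrix with entry
at row `i_j` and column `(r_{j-1}, r_j)` equal to `G^(j)(r_{j-1}, i_j, r_j)`.  Core indices
live in `Fin N` with cyclic arithmetic, so that `R_0 = R_N` automatically. -/
def coreUnfold {N : ℕ} [NeZero N] (R I : Fin N → ℕ)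
    (G : ∀ j : Fin N, Fin (R (j - 1)) → Fin (I j) → Fin (R j) → ℝ) (j : Fin N) :
    Matrix (Fin (I j)) (Fin (R (j - 1)) × Fin (R j)) ℝ :=
  fun i rr => G j rr.1 i rr.2

/-- The mode-2 unfolding `G_[2]^(≠n)` of the subchain tensor obtained by merging all TR cores
except the `n`-th.  Rows are indexed by the multi-index `ib = (i_j)_{j ≠ n}`, columns by the
pair `(r_{n-1}, r_n)`, and the entry is the sum over all remaining rank indices of the
product of the core entries. -/
def subchainUnfold {N : ℕ} [NeZero N] (R I : Fin N → ℕ)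
    (G : ∀ j : Fin N, Fin (R (j - 1)) → Fin (I j) → Fin (R j) → ℝ) (n : Fin N) :
    Matrix (∀ j : {k : Fin N // k ≠ n}, Fin (I j.1)) (Fin (R (n - 1)) × Fin (R n)) ℝ :=
  fun ib rr => ∑ r : ∀ j : Fin N, Fin (R j),
    if r (n - 1) = rr.1 ∧ r n = rr.2 then
      ∏ j : {k : Fin N // k ≠ n}, G j.1 (r (j.1 - 1)) (ib j) (r j.1)
    else 0

/-- Kronecker product of a finite family of matrices, with rows and columns indexed by the
corresponding multi-indices: the `(i, r)` entry is `∏ j, A j (i j) (r j)`. -/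
def piKronecker {ι : Type*} [Fintype ι] {m n : ι → Type*}
    [∀ j, Fintype (m j)] [∀ j, Fintype (n j)]
    (A : ∀ j, Matrix (m j) (n j) ℝ) : Matrix (∀ j, m j) (∀ j, n j) ℝ :=
  fun i r => ∏ j, A j (i j) (r j)

theorem colSpace_mul_le {l m n : Type*} [Fintype l] [Fintype m] [Fintype n]
    [DecidableEq m] [DecidableEq n] (A : Matrix l m ℝ) (B : Matrix m n ℝ) :
    colSpace (A * B) ≤ colSpace A := by
  rintro _ ⟨x, rfl⟩
  refine ⟨Matrix.toEuclideanLin B x, ?_⟩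
  simp [Matrix.toLpLin_apply, Matrix.mulVec_mulVec]

/-- The selection matrix sending the column `(r_{n-1}, r_n)` to the sum of the Kronecker columns
`((r_{j-1}, r_j))_{j ≠ n}` over all remaining rank indices. -/
def rankSelection {N : ℕ} [NeZero N] (R : Fin N → ℕ) (n : Fin N) :
    Matrix (∀ j : {k : Fin N // k ≠ n}, Fin (R (j.1 - 1)) × Fin (R j.1))
      (Fin (R (n - 1)) × Fin (R n)) ℝ :=
  fun s rr => ∑ r : ∀ j : Fin N, Fin (R j),
    if r (n - 1) = rr.1 ∧ r n = rr.2 then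
      if s = fun j : {k : Fin N // k ≠ n} => (r (j.1 - 1), r j.1) then 1 else 0
    else 0

theorem subchainUnfold_eq_piKronecker_mul {N : ℕ} [NeZero N] (R I : Fin N → ℕ)
    (G : ∀ j : Fin N, Fin (R (j - 1)) → Fin (I j) → Fin (R j) → ℝ) (n : Fin N) :
    subchainUnfold R I G n =
      (piKronecker fun j : {k : Fin N // k ≠ n} => coreUnfold R I G j.1) *
        rankSelection R n := by
  ext ib rr
  simp only [subchainUnfold, rankSelection, Matrix.mul_apply, Finset.mul_sum]
  rw [Finset.sum_comm]
  refine Finset.sum_congr rfl fun r _ => ?_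
  split_ifs <;> simp [piKronecker, coreUnfold]

/-- The column space of the mode-2 unfolding of the subchain tensor `G^(≠n)` is contained in
the column space of the Kronecker product of the classical mode-2 unfoldings of the
remaining cores. -/
theorem subchain_range_subset_kronecker_range {N : ℕ} [NeZero N] (R I : Fin N → ℕ)
    (G : ∀ j : Fin N, Fin (R (j - 1)) → Fin (I j) → Fin (R j) → ℝ) (n : Fin N) :
    colSpace (subchainUnfold R I G n) ≤
      colSpace (piKronecker fun j : {k : Fin N // k ≠ n} => coreUnfold R I G j.1) := by
  rw [subchainUnfold_eq_piKronecker_mul]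
  exact colSpace_mul_le _ _

end
end

section
/- Let A ∈ ℝ^{I × R} with I > R, let Y ∈ ℝ^{I × M}, and set OPT := min_X ‖A X − Y‖_F. Let U ∈ ℝ^{I × rank(A)} contain the left singular vectors of A, let U^⊥ be an orthogonal matrix whose columns span the orthogonal complement of range(U), and define Y^⊥ := U^⊥ (U^⊥)ᵀ Y. Let S ∈ ℝ^{J × I} be any matrix satisfying (1) σ_min²(S U) ≥ 1/√2 and (2) ‖Uᵀ Sᵀ S Y^⊥‖_F² ≤ (ε/2)·OPT² for some ε ∈ (0,1). Then any X̃ minimizing ‖S A X − S Y‖_F over X satisfies ‖A X̃ − Y‖_F ≤ (1+ε)·OPT. -/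
open Matrix

noncomputable section

/-- Frobenius norm of a real matrix. -/
def frobNorm {m n : Type*} [Fintype m] [Fintype n] (M : Matrix m n ℝ) : ℝ :=
  Real.sqrt (∑ i, ∑ j, (M i j) ^ 2)

lemma frobNorm_nonneg {m n : Type*} [Fintype m] [Fintype n] (M : Matrix m n ℝ) :
    0 ≤ frobNorm M := Real.sqrt_nonneg _

lemma frobNorm_sq {m n : Type*} [Fintype m] [Fintype n] (M : Matrix m n ℝ) :
    frobNorm M ^ 2 = (Mᵀ * M).trace := by
  rw [frobNorm, Real.sq_sqrt (by positivity), Finset.sum_comm]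
  simp [Matrix.trace, Matrix.mul_apply, sq]

lemma eq_zero_of_frobNorm_sq_eq_zero {m n : Type*} [Fintype m] [Fintype n] {M : Matrix m n ℝ}
    (h : frobNorm M ^ 2 = 0) : M = 0 := by
  rw [frobNorm_sq] at h
  simpa using Matrix.trace_conjTranspose_mul_self_eq_zero_iff.mp h

lemma frobNorm_add_sq {m n : Type*} [Fintype m] [Fintype n] (M N : Matrix m n ℝ) :
    frobNorm (M + N) ^ 2 = frobNorm M ^ 2 + 2 * (Nᵀ * M).trace + frobNorm N ^ 2 := by
  have h : (Mᵀ * N).trace = (Nᵀ * M).trace := by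
    rw [← Matrix.trace_transpose, Matrix.transpose_mul, Matrix.transpose_transpose]
  simp only [frobNorm_sq, Matrix.transpose_add, Matrix.add_mul, Matrix.mul_add,
    Matrix.trace_add, h]
  ring

lemma frobNorm_smul_sq {m n : Type*} [Fintype m] [Fintype n] (c : ℝ) (M : Matrix m n ℝ) :
    frobNorm (c • M) ^ 2 = c ^ 2 * frobNorm M ^ 2 := by
  simp only [frobNorm_sq, Matrix.transpose_smul, Matrix.smul_mul, Matrix.mul_smul,
    Matrix.trace_smul, smul_eq_mul]
  ring

lemma toEuclideanLin_mem_colSpace {m n : Type*} [Fintype m] [Fintype n] [DecidableEq n]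
    (A : Matrix m n ℝ) (v : EuclideanSpace ℝ n) : Matrix.toEuclideanLin A v ∈ colSpace A :=
  ⟨v, rfl⟩

lemma toLp_col_mem_colSpace {m n : Type*} [Fintype m] [Fintype n] [DecidableEq n]
    (A : Matrix m n ℝ) (j : n) : WithLp.toLp 2 (fun i => A i j) ∈ colSpace A := by
  convert toEuclideanLin_mem_colSpace A (EuclideanSpace.single j 1) using 1
  ext i
  simp [Matrix.toLpLin_apply]

lemma exists_eq_mul_of_colSpace_le {m n k : Type*} [Fintype m] [Fintype n] [Fintype k]
    [DecidableEq n] [DecidableEq k] {A : Matrix m n ℝ} {B : Matrix m k ℝ}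
    (h : colSpace A ≤ colSpace B) : ∃ C : Matrix k n ℝ, A = B * C := by
  choose v hv using fun j => h (toLp_col_mem_colSpace A j)
  refine ⟨Matrix.of fun i j => v j i, ?_⟩
  ext i j
  have := congrArg (fun w : EuclideanSpace ℝ m => w i) (hv j)
  simpa [Matrix.toLpLin_apply, Matrix.mulVec, dotProduct, Matrix.mul_apply] using this.symm

lemma transpose_mul_eq_zero_of_colSpace_le {m n k : Type*} [Fintype m] [Fintype n] [Fintype k]
    [DecidableEq n] [DecidableEq k] {A : Matrix m n ℝ} {B : Matrix m k ℝ}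
    (h : colSpace B ≤ (colSpace A)ᗮ) : Aᵀ * B = 0 := by
  ext i j
  have := (Submodule.mem_orthogonal _ _).mp (h (toLp_col_mem_colSpace B j)) _
    (toLp_col_mem_colSpace A i)
  simpa [PiLp.inner_apply, Matrix.mul_apply, mul_comm] using this

/-- If two matrices with orthonormal columns have complementary orthogonal column spaces, the
corresponding projections sum to the identity. -/
lemma mul_transpose_add_mul_transpose_eq_one {m n k : Type*} [Fintype m] [Fintype n] [Fintype k]
    [DecidableEq m] [DecidableEq n] [DecidableEq k] {U : Matrix m n ℝ} {V : Matrix m k ℝ}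
    (hU : Uᵀ * U = 1) (hV : Vᵀ * V = 1) (h : colSpace V = (colSpace U)ᗮ) :
    U * Uᵀ + V * Vᵀ = 1 := by
  have hUV : Uᵀ * V = 0 := transpose_mul_eq_zero_of_colSpace_le h.le
  have hVU : Vᵀ * U = 0 := by simpa using congrArg Matrix.transpose hUV
  obtain ⟨C, hC⟩ : ∃ C : Matrix k m ℝ, 1 - U * Uᵀ = V * C := by
    refine exists_eq_mul_of_colSpace_le ?_
    rw [h]
    rintro _ ⟨v, rfl⟩
    refine (Submodule.mem_orthogonal _ _).mpr ?_
    rintro _ ⟨w, rfl⟩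
    have hz : (1 - U * Uᵀ)ᵀ * U = 0 := by
      simp [Matrix.sub_mul, Matrix.mul_assoc, hU]
    have := congrArg (fun N : Matrix m n ℝ => dotProduct (WithLp.ofLp v) (N *ᵥ WithLp.ofLp w)) hz
    simp only [← Matrix.mulVec_mulVec, Matrix.dotProduct_mulVec, Matrix.vecMul_transpose] at this
    simpa [Matrix.toLpLin_apply, EuclideanSpace.inner_eq_star_dotProduct,
      Matrix.dotProduct_mulVec, Matrix.sub_mulVec] using this
  have hCV : C = Vᵀ := by
    have := congrArg (Vᵀ * ·) hC
    simpa [Matrix.mul_sub, ← Matrix.mul_assoc, hVU, hV] using this.symm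
  rw [← hCV, ← hC, add_sub_cancel]

/-- Pythagoras for a matrix with orthonormal columns. -/
lemma frobNorm_mul_sub_sq {m n k : Type*} [Fintype m] [Fintype n] [Fintype k] [DecidableEq n]
    {U : Matrix m n ℝ} (hU : Uᵀ * U = 1) {P : Matrix m k ℝ} (hP : Uᵀ * P = 0)
    (K : Matrix n k ℝ) :
    frobNorm (U * K - P) ^ 2 = frobNorm K ^ 2 + frobNorm P ^ 2 := by
  have hP' : Pᵀ * U = 0 := by simpa using congrArg Matrix.transpose hP
  have hK : Kᵀ * Uᵀ * (U * K) = Kᵀ * K := by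
    rw [Matrix.mul_assoc, ← Matrix.mul_assoc Uᵀ, hU, Matrix.one_mul]
  simp [frobNorm_sq, Matrix.sub_mul, Matrix.mul_sub, hK, Matrix.mul_assoc Kᵀ Uᵀ P, hP,
    ← Matrix.mul_assoc Pᵀ U K, hP']

/-- Normal equations for a least squares minimizer. -/
lemma transpose_mul_residual_eq_zero {m n k : Type*} [Fintype m] [Fintype n] [Fintype k]
    {B : Matrix m n ℝ} {Y : Matrix m k ℝ} {X₀ : Matrix n k ℝ}
    (h : ∀ X : Matrix n k ℝ, frobNorm (B * X₀ - Y) ≤ frobNorm (B * X - Y)) :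
    Bᵀ * (B * X₀ - Y) = 0 := by
  set E := B * X₀ - Y with hE
  set N := Bᵀ * E with hN
  have hquad (t : ℝ) : 0 ≤ frobNorm (B * N) ^ 2 * (t * t) + 2 * frobNorm N ^ 2 * t + 0 := by
    have hle := pow_le_pow_left₀ (frobNorm_nonneg _) (h (X₀ + t • N)) 2
    have hres : B * (X₀ + t • N) - Y = E + t • (B * N) := by
      rw [Matrix.mul_add, Matrix.mul_smul, hE]
      abel
    have hcross : ((t • (B * N))ᵀ * E).trace = t * frobNorm N ^ 2 := by
      rw [frobNorm_sq, Matrix.transpose_smul, Matrix.smul_mul, Matrix.trace_smul,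
        Matrix.transpose_mul, Matrix.mul_assoc, ← hN, smul_eq_mul]
    rw [hres, frobNorm_add_sq, hcross, frobNorm_smul_sq] at hle
    linarith
  have hd := discrim_le_zero hquad
  rw [discrim] at hd
  apply eq_zero_of_frobNorm_sq_eq_zero
  nlinarith [sq_nonneg (frobNorm N ^ 2)]

/-- If `G - c` is positive semidefinite with `0 ≤ c`, then `G` expands Frobenius norms by at
least `c`. -/
lemma sq_mul_frobNorm_sq_le_of_posSemidef {n k : Type*} [Fintype n] [Fintype k] [DecidableEq n]
    {G : Matrix n n ℝ} {c : ℝ} (hc : 0 ≤ c) (hG : (G - c • (1 : Matrix n n ℝ)).PosSemidef)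
    (Z : Matrix n k ℝ) : c ^ 2 * frobNorm Z ^ 2 ≤ frobNorm (G * Z) ^ 2 := by
  have hsplit : G * Z = (G - c • (1 : Matrix n n ℝ)) * Z + c • Z := by
    simp [Matrix.sub_mul]
  have htr : 0 ≤ (Zᵀ * ((G - c • (1 : Matrix n n ℝ)) * Z)).trace := by
    have := (hG.conjTranspose_mul_mul_same Z).trace_nonneg
    rwa [Matrix.conjTranspose_eq_transpose_of_trivial, Matrix.mul_assoc] at this
  rw [hsplit, frobNorm_add_sq, frobNorm_smul_sq, Matrix.transpose_smul, Matrix.smul_mul,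
    Matrix.trace_smul, smul_eq_mul]
  nlinarith [sq_nonneg (frobNorm ((G - c • (1 : Matrix n n ℝ)) * Z)), mul_nonneg hc htr]

/-- Structural conditions for sampled least squares (Lemma 4 / Drineas et al., multiple right
hand sides).  Here `U` is a matrix whose columns are the left singular vectors of `A`
(orthonormal columns spanning `range A`), `Uperp` an orthonormal basis of the orthogonal
complement of `range U`, and `Yperp = Uperp Uperpᵀ Y`.  The condition
`σ_min²(S U) ≥ 1/√2` is expressed as positive semidefiniteness of
`(S U)ᵀ (S U) - (√2)⁻¹ • 1`.  If moreover `‖Uᵀ Sᵀ S Yperp‖_F² ≤ (ε/2)·OPT²`, then any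
minimizer `Xt` of the sampled problem satisfies `‖A Xt - Y‖_F ≤ (1+ε)·OPT`. -/
theorem sampled_least_squares_structural {Id R M J : ℕ} (hIR : Id > R)
    (A : Matrix (Fin Id) (Fin R) ℝ) (Y : Matrix (Fin Id) (Fin M) ℝ)
    (OPT : ℝ) (hOPT : OPT = ⨅ X : Matrix (Fin R) (Fin M) ℝ, frobNorm (A * X - Y))
    (U : Matrix (Fin Id) (Fin A.rank) ℝ)
    (hUorth : Uᵀ * U = 1) (hUA : colSpace U = colSpace A)
    {L : ℕ} (Uperp : Matrix (Fin Id) (Fin L) ℝ)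
    (hUperpOrth : Uperpᵀ * Uperp = 1)
    (hUperpSpan : colSpace Uperp = (colSpace U)ᗮ)
    (Yperp : Matrix (Fin Id) (Fin M) ℝ) (hYperp : Yperp = Uperp * Uperpᵀ * Y)
    (ε : ℝ) (hε : ε ∈ Set.Ioo (0 : ℝ) 1)
    (S : Matrix (Fin J) (Fin Id) ℝ)
    (h1 : ((S * U)ᵀ * (S * U) -
      (Real.sqrt 2)⁻¹ • (1 : Matrix (Fin A.rank) (Fin A.rank) ℝ)).PosSemidef)
    (h2 : frobNorm (Uᵀ * Sᵀ * (S * Yperp)) ^ 2 ≤ ε / 2 * OPT ^ 2)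
    (Xt : Matrix (Fin R) (Fin M) ℝ)
    (hXt : ∀ X : Matrix (Fin R) (Fin M) ℝ,
      frobNorm (S * (A * Xt) - S * Y) ≤ frobNorm (S * (A * X) - S * Y)) :
    frobNorm (A * Xt - Y) ≤ (1 + ε) * OPT := by
  obtain ⟨hε0, hε1⟩ := hε
  obtain ⟨C, hC⟩ := exists_eq_mul_of_colSpace_le hUA.ge
  obtain ⟨B, hB⟩ := exists_eq_mul_of_colSpace_le hUA.le
  have hperp : Uᵀ * Yperp = 0 := by
    rw [hYperp, Matrix.mul_assoc, ← Matrix.mul_assoc,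
      transpose_mul_eq_zero_of_colSpace_le hUperpSpan.le, Matrix.zero_mul]
  have hY : Y = U * (Uᵀ * Y) + Yperp := by
    rw [hYperp, ← Matrix.mul_assoc, ← Matrix.add_mul,
      mul_transpose_add_mul_transpose_eq_one hUorth hUperpOrth hUperpSpan, Matrix.one_mul]
  have hres (X : Matrix (Fin R) (Fin M) ℝ) : A * X - Y = U * (C * X - Uᵀ * Y) - Yperp := by
    rw [Matrix.mul_sub, ← Matrix.mul_assoc, ← hC, sub_sub, ← hY]
  have hpyth (X : Matrix (Fin R) (Fin M) ℝ) := hres X ▸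
    frobNorm_mul_sub_sq hUorth hperp (C * X - Uᵀ * Y)
  have hYperpOPT : frobNorm Yperp ≤ OPT := by
    rw [hOPT]
    refine le_ciInf fun X => ?_
    refine (pow_le_pow_iff_left₀ (frobNorm_nonneg _) (frobNorm_nonneg _) two_ne_zero).mp ?_
    nlinarith [hpyth X, sq_nonneg (frobNorm (C * X - Uᵀ * Y))]
  have hOPT0 : 0 ≤ OPT := (frobNorm_nonneg _).trans hYperpOPT
  set Z := C * Xt - Uᵀ * Y with hZ
  have hnormal : (S * U)ᵀ * (S * U) * Z = Uᵀ * Sᵀ * (S * Yperp) := by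
    have hA : (S * A)ᵀ * (S * (A * Xt - Y)) = 0 := by
      rw [Matrix.mul_sub, ← Matrix.mul_assoc]
      refine transpose_mul_residual_eq_zero fun X => ?_
      simpa only [Matrix.mul_assoc] using hXt X
    have hSU : (S * U)ᵀ = Bᵀ * (S * A)ᵀ := by
      rw [← Matrix.transpose_mul, Matrix.mul_assoc, ← hB]
    have hU0 : (S * U)ᵀ * (S * (A * Xt - Y)) = 0 := by
      rw [hSU, Matrix.mul_assoc, hA, Matrix.mul_zero]
    rw [hres, Matrix.mul_sub, Matrix.mul_sub, sub_eq_zero] at hU0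
    simpa only [Matrix.transpose_mul, Matrix.mul_assoc] using hU0
  have hZle := sq_mul_frobNorm_sq_le_of_posSemidef (by positivity) h1 Z
  rw [hnormal, inv_pow, Real.sq_sqrt (by norm_num)] at hZle
  refine (pow_le_pow_iff_left₀ (frobNorm_nonneg _) (by positivity) two_ne_zero).mp ?_
  have hYsq := pow_le_pow_left₀ (frobNorm_nonneg _) hYperpOPT 2
  have hεOPT : 0 ≤ ε * OPT ^ 2 := by positivity
  have hεOPT' : 0 ≤ ε ^ 2 * OPT ^ 2 := by positivity
  rw [hpyth Xt]
  nlinarith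

end
end

section
/- Let X ∈ ℝ^{I_1 × ⋯ × I_N} be a tensor, let G^{(1)}, …, G^{(N)} be TR cores with G^{(j)} ∈ ℝ^{R_{j-1} × I_j × R_j} and R_0 = R_N, and let TR((G^{(j)})_{j=1}^N) denote the tensor they generate. Then for every n ∈ [N], ‖TR((G^{(j)})_{j=1}^N) − X‖_F = ‖G_{[2]}^{≠n} G_{(2)}^{(n)ᵀ} − X_{[n]}ᵀ‖_F. -/
open Matrix

noncomputable section

/-- The tensor generated by the TR cores `G^(1), …, G^(N)`:
`TR(G)(i) = Σ_{r} ∏_j G^(j)(r_{j-1}, i_j, r_j)`, where the rank indices are cyclic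
(`r_0 = r_N`).  Core indices live in `Fin N` with cyclic arithmetic. -/
def trTensor {N : ℕ} [NeZero N] (R I : Fin N → ℕ)
    (G : ∀ j : Fin N, Fin (R (j - 1)) → Fin (I j) → Fin (R j) → ℝ) :
    (∀ j : Fin N, Fin (I j)) → ℝ :=
  fun i => ∑ r : ∀ j : Fin N, Fin (R j), ∏ j : Fin N, G j (r (j - 1)) (i j) (r j)

/-- The mode-`n` unfolding `X_[n]` of a tensor `X`: rows are indexed by `i_n` and columns by
the multi-index over the remaining modes. -/
def modeUnfold {N : ℕ} {I : Fin N → ℕ} (X : (∀ j : Fin N, Fin (I j)) → ℝ) (n : Fin N) :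
    Matrix (Fin (I n)) (∀ j : {k : Fin N // k ≠ n}, Fin (I j.1)) ℝ :=
  fun iN ib => X fun j => if h : j = n then Fin.cast (congrArg I h).symm iN else ib ⟨j, h⟩

lemma modeUnfold_eq_apply_piSplitAt_symm {N : ℕ} {I : Fin N → ℕ}
    (X : (∀ j : Fin N, Fin (I j)) → ℝ) (n : Fin N) (a : Fin (I n))
    (b : ∀ j : {k : Fin N // k ≠ n}, Fin (I j.1)) :
    modeUnfold X n a b = X ((Equiv.piSplitAt n fun j => Fin (I j)).symm (a, b)) := by
  unfold modeUnfold
  congr 1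
  funext j
  by_cases h : j = n
  · subst h
    simp
  · simp [h]

lemma subchainUnfold_mul_coreUnfold_transpose {N : ℕ} [NeZero N] (R I : Fin N → ℕ)
    (G : ∀ j : Fin N, Fin (R (j - 1)) → Fin (I j) → Fin (R j) → ℝ) (n : Fin N) :
    subchainUnfold R I G n * (coreUnfold R I G n)ᵀ = (modeUnfold (trTensor R I G) n)ᵀ := by
  ext b a
  rw [Matrix.transpose_apply, modeUnfold_eq_apply_piSplitAt_symm, Matrix.mul_apply]
  simp only [subchainUnfold, coreUnfold, Matrix.transpose_apply, Finset.sum_mul, trTensor]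
  rw [Finset.sum_comm]
  refine Finset.sum_congr rfl fun r _ => ?_
  rw [Finset.sum_eq_single (r (n - 1), r n), Fintype.prod_eq_mul_prod_subtype_ne _ n]
  · simp only [and_self, if_true]
    rw [mul_comm]
    congr 1
    · simp
    · refine Finset.prod_congr rfl fun j _ => ?_
      simp [j.2]
  · rintro ⟨p, q⟩ _ hne
    rw [if_neg, zero_mul]
    rintro ⟨rfl, rfl⟩
    exact hne rfl
  · simp

/-- The TR-ALS objective identity (Zhao et al., Thm 3.5): for every mode `n`, the Frobenius
norm of `TR((G^(j))_j) - X` equals the Frobenius norm of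
`G_[2]^(≠n) · G_(2)^(n)ᵀ - X_[n]ᵀ`. -/
theorem tr_objective_eq_unfolded_objective {N : ℕ} [NeZero N] (R I : Fin N → ℕ)
    (X : (∀ j : Fin N, Fin (I j)) → ℝ)
    (G : ∀ j : Fin N, Fin (R (j - 1)) → Fin (I j) → Fin (R j) → ℝ) (n : Fin N) :
    Real.sqrt (∑ i : ∀ j : Fin N, Fin (I j), (trTensor R I G i - X i) ^ 2) =
      frobNorm (subchainUnfold R I G n * (coreUnfold R I G n)ᵀ - (modeUnfold X n)ᵀ) := by
  rw [subchainUnfold_mul_coreUnfold_transpose, frobNorm,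
    ← (Equiv.piSplitAt n fun j => Fin (I j)).symm.sum_comp, Fintype.sum_prod_type,
    Finset.sum_comm]
  simp only [Matrix.sub_apply, Matrix.transpose_apply, modeUnfold_eq_apply_piSplitAt_symm]

end
end
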